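/- arXiv:2101.01672 — 5 statements merged into one kernel-verified Lean document; each statement's English description precedes it below -/
import Mathlib

section
/- Let A = (a_{ij}) be a real N×N Z-matrix, let D be a real diagonal N×N matrix, and let u ∈ ℝ^N be a vector whose entries all have the same sign (all nonnegative, or all nonpositive). Then ⟨[[A,D],D]u, u⟩ ≤ 0. -/
open Matrix

/-- The entries of the double commutator of `A` with a diagonal matrix. -/
theorem double_commutator_diagonal_apply {n R : Type*} [Fintype n] [DecidableEq n] [CommRing R]
    (A : Matrix n n R) (d : n → R) (i j : n) :
    ((A * Matrix.diagonal d - Matrix.diagonal d * A) * Matrix.diagonal d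
        - Matrix.diagonal d * (A * Matrix.diagonal d - Matrix.diagonal d * A)) i j
      = A i j * (d i - d j) ^ 2 := by
  simp only [Matrix.sub_apply, Matrix.mul_diagonal, Matrix.diagonal_mul]
  ring

/-- For a real `Z`-matrix `A` (nonpositive off-diagonal entries), a real diagonal
matrix `D = diagonal d`, and a vector `u` whose entries all have the same sign,
`⟨[[A,D],D]u, u⟩ ≤ 0`. -/
theorem double_commutator_nonpos {N : ℕ} (A : Matrix (Fin N) (Fin N) ℝ)
    (hZ : ∀ i j, i ≠ j → A i j ≤ 0) (d : Fin N → ℝ) (u : Fin N → ℝ)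
    (hu : (∀ i, 0 ≤ u i) ∨ (∀ i, u i ≤ 0)) :
    (((A * Matrix.diagonal d - Matrix.diagonal d * A) * Matrix.diagonal d
        - Matrix.diagonal d * (A * Matrix.diagonal d - Matrix.diagonal d * A)).mulVec u) ⬝ᵥ u
      ≤ 0 := by
  have huu : ∀ i j, 0 ≤ u j * u i := fun i j => hu.elim
    (fun h => mul_nonneg (h j) (h i)) (fun h => mul_nonneg_of_nonpos_of_nonpos (h j) (h i))
  simp only [dotProduct, Matrix.mulVec, double_commutator_diagonal_apply, Finset.sum_mul]
  refine Finset.sum_nonpos fun i _ => Finset.sum_nonpos fun j _ => ?_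
  rcases eq_or_ne i j with rfl | hij
  · simp
  · rw [mul_assoc]
    exact mul_nonpos_of_nonpos_of_nonneg
      (mul_nonpos_of_nonpos_of_nonneg (hZ i j hij) (sq_nonneg _)) (huu i j)
end

section
/- Let A, Ψ, G be real symmetric N×N matrices such that ΨG = GΨ, and let u ∈ ℝ^N. Then ⟨G[Ψ,A]u, GΨu⟩ = (1/2)⟨[[A,GΨ],GΨ]u, u⟩ − (1/2)⟨[[A,G],G]Ψu, Ψu⟩. -/
open Matrix

/-- Moving a matrix across the dot product turns a pairing into a quadratic form. -/
theorem mulVec_dotProduct_mulVec_eq {n R : Type*} [Fintype n] [CommRing R]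
    (M B : Matrix n n R) (u v : n → R) :
    (M *ᵥ u) ⬝ᵥ (B *ᵥ v) = ((Bᵀ * M) *ᵥ u) ⬝ᵥ v := by
  rw [dotProduct_mulVec, ← mulVec_transpose, mulVec_mulVec]

/-- A matrix and its transpose have the same quadratic form. -/
theorem transpose_mulVec_dotProduct_self {n R : Type*} [Fintype n] [CommRing R]
    (M : Matrix n n R) (u : n → R) : (Mᵀ *ᵥ u) ⬝ᵥ u = (M *ᵥ u) ⬝ᵥ u := by
  rw [mulVec_transpose, ← dotProduct_mulVec, dotProduct_comm]

/-- For real symmetric `N×N` matrices `A, Ψ, G` with `ΨG = GΨ` and any `u ∈ ℝ^N`,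
`⟨G[Ψ,A]u, GΨu⟩ = (1/2)⟨[[A,GΨ],GΨ]u, u⟩ − (1/2)⟨[[A,G],G]Ψu, Ψu⟩`. -/
theorem double_commutator_lemma {N : ℕ} (A Ψ G : Matrix (Fin N) (Fin N) ℝ)
    (hA : A.IsSymm) (hΨ : Ψ.IsSymm) (hG : G.IsSymm) (hcomm : Ψ * G = G * Ψ)
    (u : Fin N → ℝ) :
    ((G * (Ψ * A - A * Ψ)).mulVec u) ⬝ᵥ ((G * Ψ).mulVec u)
      = (1 / 2) * ((((A * (G * Ψ) - (G * Ψ) * A) * (G * Ψ)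
            - (G * Ψ) * (A * (G * Ψ) - (G * Ψ) * A)).mulVec u) ⬝ᵥ u)
        - (1 / 2) * ((((A * G - G * A) * G - G * (A * G - G * A)).mulVec (Ψ.mulVec u))
            ⬝ᵥ (Ψ.mulVec u)) := by
  have sum_transpose : (G * Ψ)ᵀ * (G * (Ψ * A - A * Ψ)) + ((G * Ψ)ᵀ * (G * (Ψ * A - A * Ψ)))ᵀ
      = ((A * (G * Ψ) - (G * Ψ) * A) * (G * Ψ) - (G * Ψ) * (A * (G * Ψ) - (G * Ψ) * A))
        - Ψᵀ * (((A * G - G * A) * G - G * (A * G - G * A)) * Ψ) := by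
    have hcomm_left (X : Matrix (Fin N) (Fin N) ℝ) : G * (Ψ * X) = Ψ * (G * X) := by
      rw [← Matrix.mul_assoc, ← hcomm, Matrix.mul_assoc]
    simp only [transpose_mul, transpose_sub, hA.eq, hΨ.eq, hG.eq, Matrix.mul_sub,
      Matrix.sub_mul, Matrix.mul_assoc, hcomm_left, ← hcomm]
    abel
  have quadratic := congrArg (fun M => (M *ᵥ u) ⬝ᵥ u) sum_transpose
  simp only [add_mulVec, add_dotProduct, transpose_mulVec_dotProduct_self] at quadratic
  rw [sub_mulVec _ (Ψᵀ * _), sub_dotProduct] at quadratic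
  rw [mulVec_mulVec, mulVec_dotProduct_mulVec_eq, mulVec_dotProduct_mulVec_eq]
  linarith
end

section
/- Let A = (a_{ij}) be a real symmetric N×N Z-matrix, let D ⊆ [N], and let φ = (φ_k) be a local eigenvector of A on D^c = [N]∖D with eigenvalue E. Let u = (u_i) ∈ ℝ^N have all entries positive, and let G = diag(G_{11},…,G_{NN}) be a real diagonal matrix. Then Σ_{k∈[N]} φ_k² G_{kk}² ((Au)_k/u_k − E) ≤ −(1/2) Σ_{i,j∈[N], i≠j} a_{ij} φ_i φ_j (G_{ii} − G_{jj})². -/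
open Matrix

/-- `φ` is a local eigenvector of `A` on `M` with eigenvalue `E`: `φ ≠ 0`, `I_M φ = φ`, and
`I_M A I_M φ = E φ`. -/
def IsLocalEigenvector {N : ℕ} (A : Matrix (Fin N) (Fin N) ℝ) (M : Finset (Fin N)) (E : ℝ)
    (φ : Fin N → ℝ) : Prop :=
  φ ≠ 0 ∧ (∀ i, i ∉ M → φ i = 0) ∧ (∀ i, i ∈ M → A.mulVec φ i = E * φ i)

/-- The weighted AM-GM inequality `2xy ≤ x² (b/a) + y² (a/b)` for positive `a` and `b`. -/
theorem two_mul_le_sq_mul_div_add_sq_mul_div {a b : ℝ} (ha : 0 < a) (hb : 0 < b) (x y : ℝ) :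
    2 * (x * y) ≤ x ^ 2 * (b / a) + y ^ 2 * (a / b) := by
  have h : x ^ 2 * (b / a) + y ^ 2 * (a / b) - 2 * (x * y) = (x * b - y * a) ^ 2 / (a * b) := by
    field_simp
    ring
  have : 0 ≤ (x * b - y * a) ^ 2 / (a * b) := by positivity
  linarith

/-- A local eigenvector satisfies the eigenvalue equation everywhere after multiplication by
its own entries. -/
theorem IsLocalEigenvector.mul_mulVec {N : ℕ} {A : Matrix (Fin N) (Fin N) ℝ}
    {M : Finset (Fin N)} {E : ℝ} {φ : Fin N → ℝ} (h : IsLocalEigenvector A M E φ) (i : Fin N) :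
    φ i * A.mulVec φ i = E * φ i ^ 2 := by
  by_cases hi : i ∈ M
  · rw [h.2.2 i hi]
    ring
  · simp [h.2.1 i hi]

/-- Let `A` be a real symmetric `Z`-matrix, `D ⊆ [N]`, `φ` a local eigenvector of
`A` on `Dᶜ` with eigenvalue `E`, `u` a vector with positive entries, and `G = diagonal g`. Then
`∑_k φ_k² g_k² ((Au)_k/u_k − E) ≤ −(1/2) ∑_{i≠j} a_{ij} φ_i φ_j (g_i − g_j)²`. -/
theorem corollary_dc {N : ℕ} (A : Matrix (Fin N) (Fin N) ℝ) (hA : A.IsSymm)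
    (hZ : ∀ i j, i ≠ j → A i j ≤ 0) (D : Finset (Fin N)) (φ : Fin N → ℝ) (E : ℝ)
    (hφ : IsLocalEigenvector A Dᶜ E φ) (u : Fin N → ℝ) (hu : ∀ i, 0 < u i)
    (g : Fin N → ℝ) :
    ∑ k : Fin N, φ k ^ 2 * g k ^ 2 * (A.mulVec u k / u k - E)
      ≤ -(1 / 2) * ∑ i : Fin N, ∑ j ∈ Finset.univ.filter (fun j => j ≠ i),
          A i j * φ i * φ j * (g i - g j) ^ 2 := by
  set F : Fin N → Fin N → ℝ := fun i j =>
    A i j * ((g i * φ i) ^ 2 * (u j / u i) - g i ^ 2 * (φ i * φ j)) with hF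
  have hL : ∑ k, φ k ^ 2 * g k ^ 2 * (A.mulVec u k / u k - E) = ∑ i, ∑ j, F i j := by
    refine Finset.sum_congr rfl fun k _ => ?_
    calc φ k ^ 2 * g k ^ 2 * (A.mulVec u k / u k - E)
        = (g k * φ k) ^ 2 / u k * A.mulVec u k - g k ^ 2 * (φ k * A.mulVec φ k) := by
          rw [hφ.mul_mulVec]
          ring
      _ = ∑ j, F k j := by
          simp only [hF, Matrix.mulVec, dotProduct, Finset.mul_sum, ← Finset.sum_sub_distrib]
          exact Finset.sum_congr rfl fun j _ => by ring
  have hR : ∀ i, ∑ j ∈ Finset.univ.filter (fun j => j ≠ i), A i j * φ i * φ j * (g i - g j) ^ 2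
      = ∑ j, A i j * φ i * φ j * (g i - g j) ^ 2 := by
    refine fun i => Finset.sum_filter_of_ne fun j _ hj hji => hj ?_
    simp [hji]
  have hpair : ∀ i j, F i j + F j i ≤ -(A i j * φ i * φ j * (g i - g j) ^ 2) := by
    intro i j
    rcases eq_or_ne i j with rfl | hij
    · simp only [hF, div_self (hu i).ne']
      exact le_of_eq (by ring)
    · have h := mul_nonneg (neg_nonneg.2 (hZ i j hij)) (sub_nonneg.2
        (two_mul_le_sq_mul_div_add_sq_mul_div (hu i) (hu j) (g i * φ i) (g j * φ j)))
      simp only [hF, hA.apply i j]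
      linarith
  have hsum : ∑ i, ∑ j, (F i j + F j i)
      ≤ ∑ i, ∑ j, -(A i j * φ i * φ j * (g i - g j) ^ 2) :=
    Finset.sum_le_sum fun i _ => Finset.sum_le_sum fun j _ => hpair i j
  have hswap : ∑ i, ∑ j, F j i = ∑ i, ∑ j, F i j := Finset.sum_comm
  simp only [Finset.sum_add_distrib, Finset.sum_neg_distrib, hswap] at hsum
  simp only [hL, hR]
  linarith
end

section
/- Let A be a real symmetric N×N Z-matrix with connectivity at most W_c for some W_c ≥ 2, let u be a vector with all entries positive, and let Ē > 0. Set ρ = ρ_{A,u,Ē}, v = (v_i), K = K_Ē as in the definitions. Let D ⊆ [N] be such that K∖D is nonempty, let φ be a local eigenvector of A on D^c = [N]∖D with eigenvalue E ≤ Ē, and let 0 < α ≤ √(2/W_c). Then (Ē − E) Σ_{k∉K} φ_k² e^{2α ρ(k, K∖D)} + (1 − α²W_c/2) Σ_{k∉K} φ_k² e^{2α ρ(k, K∖D)} v_k ≤ (W_c/2) ‖φ‖² · max{|a_{ij}| : i ∈ K∖D, j ∉ K∖D}. -/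
open scoped ENNReal BigOperators
open Matrix

/-- The effective potential `(Au)_i / u_i`. -/
noncomputable def effV {N : ℕ} (A : Matrix (Fin N) (Fin N) ℝ) (u : Fin N → ℝ) (i : Fin N) : ℝ :=
  A.mulVec u i / u i

/-- The shifted effective potential `v_i = ((Au)_i/u_i - E)_+`. -/
noncomputable def shiftedV {N : ℕ} (A : Matrix (Fin N) (Fin N) ℝ) (u : Fin N → ℝ) (E : ℝ)
    (i : Fin N) : ℝ :=
  max (effV A u i - E) 0

/-- The weight of an edge `(i,j)`: `ln(1 + √(√(v_i v_j)/|a_ij|))`. -/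
noncomputable def edgeW {N : ℕ} (A : Matrix (Fin N) (Fin N) ℝ) (u : Fin N → ℝ) (E : ℝ)
    (i j : Fin N) : ℝ≥0∞ :=
  ENNReal.ofReal
    (Real.log (1 + Real.sqrt (Real.sqrt (shiftedV A u E i * shiftedV A u E j) / |A i j|)))

/-- The Agmon-type distance `ρ_{A,u,E}(i,j)`: infimum over paths `i = i_0, …, i_L = j` with
`a_{i_ℓ i_{ℓ+1}} ≠ 0` of the total edge weight; `∞` if there is no such path. -/
noncomputable def agmonDist {N : ℕ} (A : Matrix (Fin N) (Fin N) ℝ) (u : Fin N → ℝ) (E : ℝ)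
    (i j : Fin N) : ℝ≥0∞ :=
  ⨅ (L : ℕ) (p : Fin (L + 1) → Fin N) (_ : p 0 = i) (_ : p (Fin.last L) = j)
    (_ : ∀ ℓ : Fin L, A (p ℓ.castSucc) (p ℓ.succ) ≠ 0),
    ∑ ℓ : Fin L, edgeW A u E (p ℓ.castSucc) (p ℓ.succ)

/-- `ρ(i, M) = inf_{j ∈ M} ρ(i,j)` (`∞` when `M = ∅`). -/
noncomputable def agmonDistToSet {N : ℕ} (A : Matrix (Fin N) (Fin N) ℝ) (u : Fin N → ℝ) (E : ℝ)
    (i : Fin N) (M : Finset (Fin N)) : ℝ≥0∞ :=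
  ⨅ j ∈ M, agmonDist A u E i j

/-- The well set `K_E = {i : v_i = 0} = {i : (Au)_i/u_i ≤ E}`. -/
noncomputable def wellSet {N : ℕ} (A : Matrix (Fin N) (Fin N) ℝ) (u : Fin N → ℝ) (E : ℝ) :
    Finset (Fin N) :=
  Finset.univ.filter fun i => effV A u i ≤ E

/-- A `Z`-matrix: nonpositive off-diagonal entries. -/
def IsZMatrix {N : ℕ} (A : Matrix (Fin N) (Fin N) ℝ) : Prop :=
  ∀ i j, i ≠ j → A i j ≤ 0

/-- Connectivity at most `W`: every row and column has at most `W` nonzero off-diagonal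
entries. -/
def ConnAtMost {N : ℕ} (A : Matrix (Fin N) (Fin N) ℝ) (W : ℕ) : Prop :=
  ∀ i : Fin N, (Finset.univ.filter fun j => j ≠ i ∧ A i j ≠ 0).card ≤ W ∧
    (Finset.univ.filter fun j => j ≠ i ∧ A j i ≠ 0).card ≤ W

/-- Extended exponential `e^x` for `x ∈ [0,∞]`. -/
noncomputable def eexp (x : ℝ≥0∞) : ℝ≥0∞ :=
  if x = ⊤ then ⊤ else ENNReal.ofReal (Real.exp x.toReal)

/-- Prepending an edge to a path bounds the Agmon distance to a point. -/
theorem agmonDist_le_edgeW_add {N : ℕ} (A : Matrix (Fin N) (Fin N) ℝ) (u : Fin N → ℝ) (E : ℝ)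
    {i j : Fin N} (hij : A i j ≠ 0) (k : Fin N) :
    agmonDist A u E i k ≤ edgeW A u E i j + agmonDist A u E j k := by
  unfold agmonDist
  simp only [ENNReal.add_iInf]
  refine le_iInf fun L => le_iInf fun p => le_iInf fun h0 => le_iInf fun hL => le_iInf fun hp => ?_
  refine iInf_le_of_le (L + 1) (iInf_le_of_le (Fin.cons i p : Fin (L + 1 + 1) → Fin N)
    (iInf_le_of_le rfl (iInf_le_of_le ?_ (iInf_le_of_le ?_ ?_))))
  · rw [← Fin.succ_last, Fin.cons_succ, hL]
  · intro l
    induction l using Fin.cases with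
    | zero => simpa [h0] using hij
    | succ l => simpa [← Fin.succ_castSucc] using hp l
  · rw [Fin.sum_univ_succ]
    simp [h0]

/-- Adjacent indices have Agmon distances to a set differing by at most the edge weight. -/
theorem agmonDistToSet_le_edgeW_add {N : ℕ} (A : Matrix (Fin N) (Fin N) ℝ) (u : Fin N → ℝ)
    (E : ℝ) {i j : Fin N} (hij : A i j ≠ 0) (S : Finset (Fin N)) :
    agmonDistToSet A u E i S ≤ edgeW A u E i j + agmonDistToSet A u E j S := by
  unfold agmonDistToSet
  simp only [ENNReal.add_iInf]
  exact le_iInf₂ fun k hk => iInf₂_le_of_le k hk (agmonDist_le_edgeW_add A u E hij k)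

theorem agmonDistToSet_eq_zero_of_mem {N : ℕ} (A : Matrix (Fin N) (Fin N) ℝ) (u : Fin N → ℝ)
    (E : ℝ) {i : Fin N} {S : Finset (Fin N)} (hi : i ∈ S) : agmonDistToSet A u E i S = 0 := by
  refine le_antisymm (iInf₂_le_of_le i hi ?_) bot_le
  exact iInf_le_of_le 0 (iInf_le_of_le (fun _ => i) (iInf_le_of_le rfl (iInf_le_of_le rfl
    (iInf_le_of_le (fun l => l.elim0) (by simp)))))

theorem agmonDistToSet_ne_top_of_adj {N : ℕ} (A : Matrix (Fin N) (Fin N) ℝ) (u : Fin N → ℝ)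
    (E : ℝ) {i j : Fin N} (hij : A i j ≠ 0) {S : Finset (Fin N)}
    (hj : agmonDistToSet A u E j S ≠ ⊤) : agmonDistToSet A u E i S ≠ ⊤ :=
  ne_top_of_le_ne_top (ENNReal.add_ne_top.2 ⟨ENNReal.ofReal_ne_top, hj⟩)
    (agmonDistToSet_le_edgeW_add A u E hij S)

/-- The ground state representation gives `∑ V_i ψ_i² ≤ ⟨ψ, A ψ⟩` with `V = Au / u`. -/
theorem sum_effV_mul_sq_le {N : ℕ} {A : Matrix (Fin N) (Fin N) ℝ} (hA : A.IsSymm)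
    (hZ : IsZMatrix A) {u : Fin N → ℝ} (hu : ∀ i, 0 < u i) (ψ : Fin N → ℝ) :
    ∑ i, effV A u i * ψ i ^ 2 ≤ ∑ i, ∑ j, A i j * ψ i * ψ j := by
  have hV : ∑ i, effV A u i * ψ i ^ 2 = ∑ i, ∑ j, A i j * u j / u i * ψ i ^ 2 := by
    refine Finset.sum_congr rfl fun i _ => ?_
    rw [effV, Matrix.mulVec, dotProduct, Finset.sum_div, Finset.sum_mul]
  have hV' : ∑ i, ∑ j, A i j * u j / u i * ψ i ^ 2 = ∑ i, ∑ j, A i j * u i / u j * ψ j ^ 2 := by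
    rw [Finset.sum_comm]
    refine Finset.sum_congr rfl fun i _ => Finset.sum_congr rfl fun j _ => ?_
    rw [hA.apply]
  have key : ∑ i, ∑ j, A i j * u j / u i * ψ i ^ 2 + ∑ i, ∑ j, A i j * u i / u j * ψ j ^ 2
      ≤ ∑ i, ∑ j, 2 * (A i j * ψ i * ψ j) := by
    simp only [← Finset.sum_add_distrib]
    refine Finset.sum_le_sum fun i _ => Finset.sum_le_sum fun j _ => ?_
    have hi := hu i
    have hj := hu j
    have heq : 2 * (A i j * ψ i * ψ j) - (A i j * u j / u i * ψ i ^ 2 +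
        A i j * u i / u j * ψ j ^ 2) = -A i j * (u i * u j * (ψ i / u i - ψ j / u j) ^ 2) := by
      field_simp
      ring
    rcases eq_or_ne i j with rfl | hij
    · rw [sub_self] at heq
      linarith
    · have : 0 ≤ -A i j * (u i * u j * (ψ i / u i - ψ j / u j) ^ 2) :=
        mul_nonneg (neg_nonneg.2 (hZ i j hij)) (by positivity)
      linarith
  simp only [← Finset.mul_sum] at key
  linarith

/-- Agmon-type energy estimate for `gφ`, where `φ` satisfies the eigenvalue equation on its
support. -/
theorem sum_effV_sub_mul_le {N : ℕ} {A : Matrix (Fin N) (Fin N) ℝ} (hA : A.IsSymm)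
    (hZ : IsZMatrix A) {u : Fin N → ℝ} (hu : ∀ i, 0 < u i) {φ : Fin N → ℝ} {E : ℝ}
    (hφ : ∀ i, φ i * A.mulVec φ i = E * φ i ^ 2) (g : Fin N → ℝ) :
    ∑ i, (effV A u i - E) * (g i * φ i) ^ 2
      ≤ 1 / 2 * ∑ i, ∑ j, |A i j| * (|φ i| * |φ j|) * (g i - g j) ^ 2 := by
  have h1 := sum_effV_mul_sq_le hA hZ hu fun i => g i * φ i
  have hrow : ∑ i, ∑ j, A i j * φ i * φ j * g i ^ 2 = ∑ i, E * (g i * φ i) ^ 2 := by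
    refine Finset.sum_congr rfl fun i _ => ?_
    calc ∑ j, A i j * φ i * φ j * g i ^ 2 = g i ^ 2 * (φ i * A.mulVec φ i) := by
          rw [Matrix.mulVec, dotProduct, Finset.mul_sum, Finset.mul_sum]
          exact Finset.sum_congr rfl fun j _ => by ring
      _ = E * (g i * φ i) ^ 2 := by rw [hφ]; ring
  have hcol : ∑ i, ∑ j, A i j * φ i * φ j * g j ^ 2 = ∑ i, E * (g i * φ i) ^ 2 := by
    rw [← hrow, Finset.sum_comm]
    refine Finset.sum_congr rfl fun i _ => Finset.sum_congr rfl fun j _ => ?_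
    rw [hA.apply]
    ring
  have h2 : ∑ i, ∑ j, 2 * (A i j * (g i * φ i) * (g j * φ j)) ≤
      ∑ i, ∑ j, A i j * φ i * φ j * g i ^ 2 + ∑ i, ∑ j, A i j * φ i * φ j * g j ^ 2 +
        ∑ i, ∑ j, |A i j| * (|φ i| * |φ j|) * (g i - g j) ^ 2 := by
    simp only [← Finset.sum_add_distrib]
    refine Finset.sum_le_sum fun i _ => Finset.sum_le_sum fun j _ => ?_
    have := mul_le_mul_of_nonneg_right (neg_le_abs (A i j * (φ i * φ j))) (sq_nonneg (g i - g j))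
    rw [abs_mul, abs_mul] at this
    linarith
  simp only [← Finset.mul_sum] at h2
  simp only [sub_mul, Finset.sum_sub_distrib]
  linarith

/-- If each edge term is at most `x i + x j`, then under connectivity at most `W` the sum over
ordered edges is at most `2 W ∑ x`. -/
theorem sum_edges_le {N : ℕ} {A : Matrix (Fin N) (Fin N) ℝ} {W : ℕ} (hconn : ConnAtMost A W)
    {x : Fin N → ℝ} (hx : ∀ i, 0 ≤ x i) {T : Fin N → Fin N → ℝ}
    (hT : ∀ i j, j ≠ i → A i j ≠ 0 → T i j ≤ x i + x j)
    (hT0 : ∀ i j, ¬(j ≠ i ∧ A i j ≠ 0) → T i j = 0) :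
    ∑ i, ∑ j, T i j ≤ 2 * W * ∑ i, x i := by
  have h1 : ∑ i, ∑ j, (if j ≠ i ∧ A i j ≠ 0 then x i else 0) ≤ W * ∑ i, x i := by
    rw [Finset.mul_sum]
    refine Finset.sum_le_sum fun i _ => ?_
    rw [← Finset.sum_filter, Finset.sum_const, nsmul_eq_mul]
    exact mul_le_mul_of_nonneg_right (by exact_mod_cast (hconn i).1) (hx i)
  have h2 : ∑ i, ∑ j, (if j ≠ i ∧ A i j ≠ 0 then x j else 0) ≤ W * ∑ i, x i := by
    rw [Finset.sum_comm, Finset.mul_sum]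
    refine Finset.sum_le_sum fun j _ => ?_
    rw [← Finset.sum_filter, Finset.sum_const, nsmul_eq_mul]
    refine mul_le_mul_of_nonneg_right ?_ (hx j)
    have := (hconn j).2
    simp only [ne_comm (b := j)] at this
    exact_mod_cast this
  have h3 : ∑ i, ∑ j, T i j ≤ ∑ i, ∑ j, ((if j ≠ i ∧ A i j ≠ 0 then x i else 0) +
      (if j ≠ i ∧ A i j ≠ 0 then x j else 0)) := by
    refine Finset.sum_le_sum fun i _ => Finset.sum_le_sum fun j _ => ?_
    split_ifs with h
    · exact hT i j h.1 h.2
    · simp [hT0 i j h]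
  simp only [Finset.sum_add_distrib] at h3
  linarith

/-- If `r ≤ log (1 + s) + t`, then `e^{αr} - e^{αt} ≤ α s e^{αt}` for `0 ≤ α ≤ 1`. -/
theorem exp_mul_sub_exp_mul_le {α r t s : ℝ} (hα0 : 0 ≤ α) (hα1 : α ≤ 1) (hs : 0 ≤ s)
    (h : r ≤ Real.log (1 + s) + t) :
    Real.exp (α * r) - Real.exp (α * t) ≤ α * s * Real.exp (α * t) := by
  have h1 : Real.exp (α * r) ≤ (1 + s) ^ α * Real.exp (α * t) := by
    rw [Real.rpow_def_of_pos (by linarith), ← Real.exp_add]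
    refine Real.exp_le_exp.2 ?_
    nlinarith [mul_le_mul_of_nonneg_left h hα0]
  have h2 : (1 + s) ^ α ≤ 1 + α * s := rpow_one_add_le_one_add_mul_self (by linarith) hα0 hα1
  nlinarith [mul_le_mul_of_nonneg_right h2 (Real.exp_pos (α * t)).le]

/-- Squared differences of exponential weights at indices whose distances differ by at most
`log (1 + s)`. -/
theorem sq_exp_mul_sub_exp_mul_le {α r t s : ℝ} (hα0 : 0 ≤ α) (hα1 : α ≤ 1) (hs : 0 ≤ s)
    (h : r ≤ Real.log (1 + s) + t) (h' : t ≤ Real.log (1 + s) + r) :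
    (Real.exp (α * r) - Real.exp (α * t)) ^ 2
      ≤ α ^ 2 * s ^ 2 * (Real.exp (α * r) * Real.exp (α * t)) := by
  have h1 := exp_mul_sub_exp_mul_le hα0 hα1 hs h
  have h2 := exp_mul_sub_exp_mul_le hα0 hα1 hs h'
  have hr := Real.exp_pos (α * r)
  have ht := Real.exp_pos (α * t)
  generalize Real.exp (α * r) = a at *
  generalize Real.exp (α * t) = b at *
  have hc : 0 ≤ α * s := mul_nonneg hα0 hs
  rw [← mul_pow]
  generalize α * s = c at *
  rcases le_total a b with hab | hab
  · have : (b - a) ^ 2 ≤ (c * a) ^ 2 := pow_le_pow_left₀ (by linarith) h2 2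
    have : c ^ 2 * (a * a) ≤ c ^ 2 * (a * b) := by gcongr
    linarith
  · have : (a - b) ^ 2 ≤ (c * b) ^ 2 := pow_le_pow_left₀ (by linarith) h1 2
    have : c ^ 2 * (b * b) ≤ c ^ 2 * (a * b) := by gcongr
    linarith

theorem edgeW_toReal {N : ℕ} (A : Matrix (Fin N) (Fin N) ℝ) (u : Fin N → ℝ) (E : ℝ)
    (i j : Fin N) : (edgeW A u E i j).toReal =
      Real.log (1 + √(√(shiftedV A u E i * shiftedV A u E j) / |A i j|)) :=
  ENNReal.toReal_ofReal (Real.log_nonneg (le_add_of_nonneg_right (Real.sqrt_nonneg _)))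

theorem agmonDistToSet_toReal_le {N : ℕ} (A : Matrix (Fin N) (Fin N) ℝ) (u : Fin N → ℝ)
    (E : ℝ) {i j : Fin N} (hij : A i j ≠ 0) {S : Finset (Fin N)}
    (hj : agmonDistToSet A u E j S ≠ ⊤) :
    (agmonDistToSet A u E i S).toReal ≤
      Real.log (1 + √(√(shiftedV A u E i * shiftedV A u E j) / |A i j|)) +
        (agmonDistToSet A u E j S).toReal := by
  have hW : edgeW A u E i j ≠ ⊤ := ENNReal.ofReal_ne_top
  rw [← edgeW_toReal, ← ENNReal.toReal_add hW hj]
  exact ENNReal.toReal_mono (ENNReal.add_ne_top.2 ⟨hW, hj⟩)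
    (agmonDistToSet_le_edgeW_add A u E hij S)

theorem shiftedV_nonneg {N : ℕ} (A : Matrix (Fin N) (Fin N) ℝ) (u : Fin N → ℝ) (E : ℝ)
    (i : Fin N) : 0 ≤ shiftedV A u E i :=
  le_max_right _ _

theorem shiftedV_eq_zero_of_mem {N : ℕ} {A : Matrix (Fin N) (Fin N) ℝ} {u : Fin N → ℝ} {E : ℝ}
    {i : Fin N} (hi : i ∈ wellSet A u E) : shiftedV A u E i = 0 := by
  simp only [wellSet, Finset.mem_filter, Finset.mem_univ, true_and] at hi
  exact max_eq_right (by linarith)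

theorem effV_sub_pos_of_notMem {N : ℕ} {A : Matrix (Fin N) (Fin N) ℝ} {u : Fin N → ℝ} {E : ℝ}
    {i : Fin N} (hi : i ∉ wellSet A u E) : 0 < effV A u i - E := by
  simpa [wellSet] using hi

/-- The cut-off exponential weight: `e^{αρ(i,S)}` off `S` where the distance is finite, and `0`
elsewhere. -/
noncomputable def agmonWeight {N : ℕ} (A : Matrix (Fin N) (Fin N) ℝ) (u : Fin N → ℝ) (E α : ℝ)
    (S : Finset (Fin N)) (i : Fin N) : ℝ :=
  open Classical in
  if i ∈ S ∨ agmonDistToSet A u E i S = ⊤ then 0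
  else Real.exp (α * (agmonDistToSet A u E i S).toReal)

/-- A local eigenvector vanishes at indices at infinite distance from the wells it can reach. -/
theorem eq_zero_of_agmonDistToSet_eq_top {N : ℕ} {A : Matrix (Fin N) (Fin N) ℝ} (hA : A.IsSymm)
    (hZ : IsZMatrix A) {u : Fin N → ℝ} (hu : ∀ i, 0 < u i) {φ : Fin N → ℝ} {E Ebar : ℝ}
    (hE : E ≤ Ebar) (hφ : ∀ i, φ i * A.mulVec φ i = E * φ i ^ 2) {D : Finset (Fin N)}
    (hD : ∀ i ∈ D, φ i = 0) {k : Fin N}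
    (hk : agmonDistToSet A u Ebar k (wellSet A u Ebar \ D) = ⊤) : φ k = 0 := by
  classical
  set S := wellSet A u Ebar \ D with hS
  set g : Fin N → ℝ := fun i => if agmonDistToSet A u Ebar i S = ⊤ then 1 else 0 with hg
  have hgadj : ∀ i j, |A i j| * (|φ i| * |φ j|) * (g i - g j) ^ 2 = 0 := by
    intro i j
    rcases eq_or_ne (A i j) 0 with h | h
    · simp [h]
    · have h' : A j i ≠ 0 := by rwa [hA.apply]
      have hiff : agmonDistToSet A u Ebar i S = ⊤ ↔ agmonDistToSet A u Ebar j S = ⊤ :=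
        ⟨fun hi => by_contra fun hj => agmonDistToSet_ne_top_of_adj A u Ebar h hj hi,
          fun hj => by_contra fun hi => agmonDistToSet_ne_top_of_adj A u Ebar h' hi hj⟩
      simp [hg, hiff]
  have hsum := sum_effV_sub_mul_le hA hZ hu hφ g
  simp only [hgadj, Finset.sum_const_zero, mul_zero] at hsum
  have hcases : ∀ i, g i * φ i = 0 ∨ 0 < effV A u i - E := by
    intro i
    by_cases hi : i ∈ wellSet A u Ebar
    · left
      by_cases hiD : i ∈ D
      · simp [hD i hiD]
      · have : i ∈ S := Finset.mem_sdiff.2 ⟨hi, hiD⟩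
        simp [hg, agmonDistToSet_eq_zero_of_mem A u Ebar this]
    · right
      linarith [effV_sub_pos_of_notMem hi]
  have hnonneg : ∀ i ∈ Finset.univ, 0 ≤ (effV A u i - E) * (g i * φ i) ^ 2 := by
    intro i _
    rcases hcases i with h | h
    · simp [h]
    · positivity
  have hzero := (Finset.sum_eq_zero_iff_of_nonneg hnonneg).1
    (le_antisymm hsum (Finset.sum_nonneg hnonneg)) k (Finset.mem_univ k)
  have hgk : g k = 1 := by simp [hg, hk]
  rcases hcases k with h | h
  · simpa [hgk] using h
  · simpa [hgk, h.ne'] using hzero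

/-- Pointwise edge bound for the weight `agmonWeight`. -/
theorem edge_term_le {N : ℕ} {A : Matrix (Fin N) (Fin N) ℝ} (hA : A.IsSymm)
    {u : Fin N → ℝ} {φ : Fin N → ℝ} {E α M : ℝ} (hα0 : 0 ≤ α) (hα1 : α ≤ 1)
    {S : Finset (Fin N)} (hS : S ⊆ wellSet A u E) (hM0 : 0 ≤ M)
    (hM : ∀ i ∈ S, ∀ j ∉ S, |A i j| ≤ M) {i j : Fin N} (hij : A i j ≠ 0) :
    |A i j| * (|φ i| * |φ j|) * (agmonWeight A u E α S i - agmonWeight A u E α S j) ^ 2 ≤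
      (α ^ 2 / 2 * ((agmonWeight A u E α S i * φ i) ^ 2 * shiftedV A u E i) + M / 2 * φ i ^ 2) +
      (α ^ 2 / 2 * ((agmonWeight A u E α S j * φ j) ^ 2 * shiftedV A u E j) +
        M / 2 * φ j ^ 2) := by
  have hji : A j i ≠ 0 := by rwa [hA.apply]
  have hvi := shiftedV_nonneg A u E i
  have hvj := shiftedV_nonneg A u E j
  have hW : ∀ {a b : Fin N}, A a b ≠ 0 → a ∈ S → b ∉ S → agmonWeight A u E α S b = 1 := by
    intro a b hab ha hb
    have h := agmonDistToSet_le_edgeW_add A u E (i := b) (j := a) (by rwa [hA.apply]) S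
    rw [agmonDistToSet_eq_zero_of_mem A u E ha, edgeW, shiftedV_eq_zero_of_mem (hS ha)] at h
    have h0 : agmonDistToSet A u E b S = 0 := by simpa using h
    simp [agmonWeight, hb, h0]
  have hin : ∀ {a : Fin N}, a ∈ S → agmonWeight A u E α S a = 0 := by
    intro a ha
    simp [agmonWeight, ha]
  have hφφ : |φ i| * |φ j| ≤ φ i ^ 2 / 2 + φ j ^ 2 / 2 := by
    nlinarith [sq_nonneg (|φ i| - |φ j|), sq_abs (φ i), sq_abs (φ j)]
  have hmixed : |A i j| ≤ M → |A i j| * (|φ i| * |φ j|) ≤ M / 2 * φ i ^ 2 + M / 2 * φ j ^ 2 := by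
    intro h
    calc |A i j| * (|φ i| * |φ j|) ≤ M * (φ i ^ 2 / 2 + φ j ^ 2 / 2) := by gcongr
      _ = _ := by ring
  have hi0 : 0 ≤ α ^ 2 / 2 * ((agmonWeight A u E α S i * φ i) ^ 2 * shiftedV A u E i) := by
    positivity
  have hj0 : 0 ≤ α ^ 2 / 2 * ((agmonWeight A u E α S j * φ j) ^ 2 * shiftedV A u E j) := by
    positivity
  have hMi : 0 ≤ M / 2 * φ i ^ 2 := by positivity
  have hMj : 0 ≤ M / 2 * φ j ^ 2 := by positivity
  by_cases hiS : i ∈ S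
  · by_cases hjS : j ∈ S
    · rw [hin hiS, hin hjS] at *
      simp only [sub_self, ne_eq, OfNat.ofNat_ne_zero, not_false_eq_true, zero_pow, mul_zero]
      linarith
    · have := hmixed (hM i hiS j hjS)
      rw [hin hiS, hW hij hiS hjS] at *
      linarith
  · by_cases hjS : j ∈ S
    · have := hmixed (by rw [← hA.apply]; exact hM j hjS i hiS)
      rw [hin hjS, hW hji hjS hiS] at *
      linarith
    · by_cases hi : agmonDistToSet A u E i S = ⊤
      · have hj : agmonDistToSet A u E j S = ⊤ :=
          by_contra fun hj => agmonDistToSet_ne_top_of_adj A u E hij hj hi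
        have hwi : agmonWeight A u E α S i = 0 := by simp [agmonWeight, hi]
        have hwj : agmonWeight A u E α S j = 0 := by simp [agmonWeight, hj]
        rw [hwi, hwj] at *
        simp only [sub_self, ne_eq, OfNat.ofNat_ne_zero, not_false_eq_true, zero_pow, mul_zero]
        linarith
      · have hj : agmonDistToSet A u E j S ≠ ⊤ := agmonDistToSet_ne_top_of_adj A u E hji hi
        have h1 := agmonDistToSet_toReal_le A u E hij hj
        have h2 := agmonDistToSet_toReal_le A u E hji hi
        rw [hA.apply i j, mul_comm (shiftedV A u E j)] at h2
        have hsq := sq_exp_mul_sub_exp_mul_le hα0 hα1 (Real.sqrt_nonneg _) h1 h2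
        rw [Real.sq_sqrt (by positivity)] at hsq
        have hwi : Real.exp (α * (agmonDistToSet A u E i S).toReal) =
          agmonWeight A u E α S i := by simp [agmonWeight, hi, hiS]
        have hwj : Real.exp (α * (agmonDistToSet A u E j S).toReal) =
          agmonWeight A u E α S j := by simp [agmonWeight, hj, hjS]
        rw [hwi, hwj, Real.sqrt_mul hvi] at hsq
        generalize agmonWeight A u E α S i = x at *
        generalize agmonWeight A u E α S j = y at *
        have ha : 0 < |A i j| := abs_pos.2 hij
        have hmain : |A i j| * (|φ i| * |φ j|) * (x - y) ^ 2 ≤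
            α ^ 2 * ((x * |φ i| * √(shiftedV A u E i)) * (y * |φ j| * √(shiftedV A u E j))) := by
          calc |A i j| * (|φ i| * |φ j|) * (x - y) ^ 2 ≤ |A i j| * (|φ i| * |φ j|) *
                (α ^ 2 * (√(shiftedV A u E i) * √(shiftedV A u E j) / |A i j|) * (x * y)) := by
                gcongr
            _ = _ := by field_simp
        have hsqi : (x * |φ i| * √(shiftedV A u E i)) ^ 2 = (x * φ i) ^ 2 * shiftedV A u E i := by
          rw [mul_pow, mul_pow, sq_abs, Real.sq_sqrt hvi, mul_pow]
        have hsqj : (y * |φ j| * √(shiftedV A u E j)) ^ 2 = (y * φ j) ^ 2 * shiftedV A u E j := by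
          rw [mul_pow, mul_pow, sq_abs, Real.sq_sqrt hvj, mul_pow]
        rw [← hsqi, ← hsqj]
        have := mul_nonneg (sq_nonneg α)
          (sq_nonneg (x * |φ i| * √(shiftedV A u E i) - y * |φ j| * √(shiftedV A u E j)))
        linarith

/-- The localization estimate in real form, for the cut-off weight. -/
theorem sum_agmonWeight_le {N : ℕ} {A : Matrix (Fin N) (Fin N) ℝ} (hA : A.IsSymm)
    (hZ : IsZMatrix A) {W : ℕ} (hconn : ConnAtMost A W) {u : Fin N → ℝ} (hu : ∀ i, 0 < u i)
    {φ : Fin N → ℝ} {E Ebar α M : ℝ} (hα0 : 0 ≤ α) (hα1 : α ≤ 1)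
    (hφ : ∀ i, φ i * A.mulVec φ i = E * φ i ^ 2) {D : Finset (Fin N)} (hD : ∀ i ∈ D, φ i = 0)
    (hM0 : 0 ≤ M)
    (hM : ∀ i ∈ wellSet A u Ebar \ D, ∀ j ∉ wellSet A u Ebar \ D, |A i j| ≤ M) :
    (Ebar - E) * ∑ k ∈ (wellSet A u Ebar)ᶜ,
        (agmonWeight A u Ebar α (wellSet A u Ebar \ D) k * φ k) ^ 2 +
      (1 - α ^ 2 * W / 2) * ∑ k ∈ (wellSet A u Ebar)ᶜ,
        (agmonWeight A u Ebar α (wellSet A u Ebar \ D) k * φ k) ^ 2 * shiftedV A u Ebar k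
      ≤ W / 2 * (∑ i, φ i ^ 2) * M := by
  set g := agmonWeight A u Ebar α (wellSet A u Ebar \ D) with hg
  have hK : ∀ i ∈ wellSet A u Ebar, g i * φ i = 0 := by
    intro i hi
    by_cases hiD : i ∈ D
    · simp [hD i hiD]
    · simp [hg, agmonWeight, hi, hiD]
  have hs1 : ∑ k ∈ (wellSet A u Ebar)ᶜ, (g k * φ k) ^ 2 = ∑ k, (g k * φ k) ^ 2 :=
    Finset.sum_subset (Finset.subset_univ _) fun i _ hi => by
      simp [hK i (by simpa using hi)]
  have hs2 : ∑ k ∈ (wellSet A u Ebar)ᶜ, (g k * φ k) ^ 2 * shiftedV A u Ebar k =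
      ∑ k, (g k * φ k) ^ 2 * shiftedV A u Ebar k :=
    Finset.sum_subset (Finset.subset_univ _) fun i _ hi => by
      simp [hK i (by simpa using hi)]
  rw [hs1, hs2]
  have henergy := sum_effV_sub_mul_le hA hZ hu hφ g
  have hsplit : ∑ i, (effV A u i - E) * (g i * φ i) ^ 2 =
      (Ebar - E) * ∑ k, (g k * φ k) ^ 2 + ∑ k, (g k * φ k) ^ 2 * shiftedV A u Ebar k := by
    rw [Finset.mul_sum, ← Finset.sum_add_distrib]
    refine Finset.sum_congr rfl fun i _ => ?_
    by_cases hi : i ∈ wellSet A u Ebar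
    · simp [hK i hi]
    · rw [shiftedV, max_eq_left (effV_sub_pos_of_notMem hi).le]
      ring
  have hedges := sum_edges_le hconn
    (x := fun i => α ^ 2 / 2 * ((g i * φ i) ^ 2 * shiftedV A u Ebar i) + M / 2 * φ i ^ 2)
    (T := fun i j => |A i j| * (|φ i| * |φ j|) * (g i - g j) ^ 2)
    (fun i => by have := shiftedV_nonneg A u Ebar i; positivity)
    (fun i j _ hij => edge_term_le hA hα0 hα1 Finset.sdiff_subset hM0 hM hij)
    (fun i j h => by
      rcases eq_or_ne j i with rfl | hne
      · simp
      · simp [show A i j = 0 from by_contra fun h0 => h ⟨hne, h0⟩])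
  rw [Finset.sum_add_distrib, ← Finset.mul_sum, ← Finset.mul_sum] at hedges
  linarith

/-- Theorem: exponential localization: Let `A` be a real symmetric `N×N`
`Z`-matrix with connectivity at most `W_c ≥ 2`, `u` a vector with positive entries, `Ē > 0`,
`D ⊆ [N]` with `K_Ē ∖ D` nonempty, `φ` a local eigenvector of `A` on `Dᶜ` with eigenvalue
`E ≤ Ē`, and `0 < α ≤ √(2/W_c)`. Then
`(Ē−E) ∑_{k∉K} φ_k² e^{2αρ(k,K∖D)} + (1−α²W_c/2) ∑_{k∉K} φ_k² e^{2αρ(k,K∖D)} v_k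
  ≤ (W_c/2)‖φ‖² max_{i∈K∖D, j∉K∖D} |a_{ij}|`. -/
theorem exponential_localization {N : ℕ} (A : Matrix (Fin N) (Fin N) ℝ)
    (hA : A.IsSymm) (hZ : IsZMatrix A) (Wc : ℕ) (hWc : 2 ≤ Wc) (hconn : ConnAtMost A Wc)
    (u : Fin N → ℝ) (hu : ∀ i, 0 < u i) (Ebar : ℝ) (hEbar : 0 < Ebar)
    (D : Finset (Fin N)) (hKD : (wellSet A u Ebar \ D).Nonempty)
    (φ : Fin N → ℝ) (E : ℝ) (hE : E ≤ Ebar) (hφ : IsLocalEigenvector A Dᶜ E φ)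
    (α : ℝ) (hα0 : 0 < α) (hα : α ≤ Real.sqrt (2 / Wc)) :
    ENNReal.ofReal (Ebar - E) *
        ∑ k ∈ (wellSet A u Ebar)ᶜ, ENNReal.ofReal (φ k ^ 2) *
          eexp (ENNReal.ofReal (2 * α) * agmonDistToSet A u Ebar k (wellSet A u Ebar \ D)) +
      ENNReal.ofReal (1 - α ^ 2 * Wc / 2) *
        ∑ k ∈ (wellSet A u Ebar)ᶜ, ENNReal.ofReal (φ k ^ 2) *
          eexp (ENNReal.ofReal (2 * α) * agmonDistToSet A u Ebar k (wellSet A u Ebar \ D)) *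
          ENNReal.ofReal (shiftedV A u Ebar k)
      ≤ ENNReal.ofReal ((Wc : ℝ) / 2 * ∑ i : Fin N, φ i ^ 2) *
          ⨆ i ∈ wellSet A u Ebar \ D, ⨆ j ∈ (wellSet A u Ebar \ D)ᶜ,
            ENNReal.ofReal |A i j| := by
  classical
  obtain ⟨-, hsupp, heig⟩ := hφ
  have hD : ∀ i ∈ D, φ i = 0 := fun i hi => hsupp i (by simpa using hi)
  have hφ' : ∀ i, φ i * A.mulVec φ i = E * φ i ^ 2 := by
    intro i
    by_cases hi : i ∈ D
    · simp [hD i hi]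
    · rw [heig i (by simpa using hi)]
      ring
  have hW : (2 : ℝ) ≤ Wc := by exact_mod_cast hWc
  have hα2 : α ^ 2 ≤ 2 / Wc := (Real.le_sqrt hα0.le (by positivity)).1 hα
  have hα1 : α ≤ 1 := by
    have : 2 / (Wc : ℝ) ≤ 1 := (div_le_one (by linarith)).2 hW
    nlinarith
  have hαW : 0 ≤ 1 - α ^ 2 * Wc / 2 := by
    have := (le_div_iff₀ (by linarith : (0 : ℝ) < Wc)).1 hα2
    linarith
  set S := wellSet A u Ebar \ D with hS
  set X : ℝ≥0∞ := ⨆ i ∈ S, ⨆ j ∈ Sᶜ, ENNReal.ofReal |A i j| with hX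
  have hXtop : X ≠ ⊤ := by
    refine ne_top_of_le_ne_top (b := ∑ i, ∑ j, ENNReal.ofReal |A i j|) ?_ ?_
    · exact ENNReal.sum_ne_top.2 fun i _ => ENNReal.sum_ne_top.2 fun j _ => ENNReal.ofReal_ne_top
    · refine iSup₂_le fun i _ => iSup₂_le fun j _ => ?_
      calc ENNReal.ofReal |A i j| ≤ ∑ j, ENNReal.ofReal |A i j| :=
            Finset.single_le_sum (f := fun j => ENNReal.ofReal |A i j|) (fun _ _ => bot_le)
              (Finset.mem_univ j)
        _ ≤ _ := Finset.single_le_sum (f := fun i => ∑ j, ENNReal.ofReal |A i j|)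
              (fun _ _ => bot_le) (Finset.mem_univ i)
  have hM : ∀ i ∈ S, ∀ j ∉ S, |A i j| ≤ X.toReal := by
    intro i hi j hj
    refine (ENNReal.ofReal_le_iff_le_toReal hXtop).1 ?_
    exact le_iSup₂_of_le i hi (le_iSup₂_of_le j (Finset.mem_compl.2 hj) le_rfl)
  have hreal := sum_agmonWeight_le hA hZ hconn hu hα0.le hα1 hφ' hD ENNReal.toReal_nonneg hM
  rw [← hS] at hreal
  have hterm : ∀ k ∈ (wellSet A u Ebar)ᶜ, ENNReal.ofReal (φ k ^ 2) *
      eexp (ENNReal.ofReal (2 * α) * agmonDistToSet A u Ebar k S) =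
        ENNReal.ofReal ((agmonWeight A u Ebar α S k * φ k) ^ 2) := by
    intro k hk
    have hkS : k ∉ S := fun h => Finset.mem_compl.1 hk (Finset.mem_sdiff.1 h).1
    by_cases hρ : agmonDistToSet A u Ebar k S = ⊤
    · simp [eq_zero_of_agmonDistToSet_eq_top hA hZ hu hE hφ' hD hρ]
    · rw [eexp, if_neg (ENNReal.mul_ne_top ENNReal.ofReal_ne_top hρ),
        ← ENNReal.ofReal_mul (sq_nonneg _), ENNReal.toReal_mul,
        ENNReal.toReal_ofReal (by positivity), agmonWeight, if_neg (by tauto), mul_pow,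
        ← Real.exp_nat_mul, mul_comm]
      push_cast
      rw [mul_assoc]
  have hterm' : ∀ k ∈ (wellSet A u Ebar)ᶜ, ENNReal.ofReal (φ k ^ 2) *
      eexp (ENNReal.ofReal (2 * α) * agmonDistToSet A u Ebar k S) *
        ENNReal.ofReal (shiftedV A u Ebar k) =
        ENNReal.ofReal ((agmonWeight A u Ebar α S k * φ k) ^ 2 * shiftedV A u Ebar k) := by
    intro k hk
    rw [hterm k hk, ENNReal.ofReal_mul (sq_nonneg _)]
  have hv : ∀ k ∈ (wellSet A u Ebar)ᶜ,
      0 ≤ (agmonWeight A u Ebar α S k * φ k) ^ 2 * shiftedV A u Ebar k :=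
    fun k _ => mul_nonneg (sq_nonneg _) (shiftedV_nonneg A u Ebar k)
  rw [Finset.sum_congr rfl hterm, Finset.sum_congr rfl hterm',
    ← ENNReal.ofReal_sum_of_nonneg fun k _ => sq_nonneg _, ← ENNReal.ofReal_sum_of_nonneg hv,
    ← ENNReal.ofReal_mul (sub_nonneg.2 hE), ← ENNReal.ofReal_mul hαW,
    ← ENNReal.ofReal_add (mul_nonneg (sub_nonneg.2 hE) (Finset.sum_nonneg fun k _ => sq_nonneg _))
      (mul_nonneg hαW (Finset.sum_nonneg hv)), ← ENNReal.ofReal_toReal hXtop,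
    ← ENNReal.ofReal_mul (by positivity)]
  exact ENNReal.ofReal_le_ofReal hreal
end

section
/- Let A be a real symmetric N×N Z-matrix, u a vector with all entries positive, D ⊆ [N], and φ a local eigenvector of A on [N]∖D with eigenvalue E. Then there exists k ∈ [N]∖D with φ_k ≠ 0 and (Au)_k/u_k ≤ E. In particular, for any Ē ≥ E the set K_Ē∖D is nonempty, where K_Ē := {i ∈ [N] : (Au)_i/u_i ≤ Ē}. -/
open scoped ENNReal BigOperators
open Matrix

/-- For a `Z`-matrix `A` and `φ ≠ 0`, at an index maximizing `|φ_k| / u_k` the effective potential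
is bounded by the local quotient of `φ`. -/
lemma IsZMatrix.exists_effV_mul_sq_le {N : ℕ} {A : Matrix (Fin N) (Fin N) ℝ} (hZ : IsZMatrix A)
    {u : Fin N → ℝ} (hu : ∀ i, 0 < u i) {φ : Fin N → ℝ} (hφ : φ ≠ 0) :
    ∃ k, φ k ≠ 0 ∧ effV A u k * φ k ^ 2 ≤ φ k * A.mulVec φ k := by
  obtain ⟨i, hi⟩ := Function.ne_iff.mp hφ
  obtain ⟨k, -, hk⟩ := Finset.exists_max_image Finset.univ (fun j => |φ j| / u j)
    ⟨i, Finset.mem_univ i⟩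
  have hφk : φ k ≠ 0 := by
    intro h
    have hik := hk i (Finset.mem_univ i)
    simp only [h, abs_zero, zero_div] at hik
    exact (div_pos (abs_pos.mpr hi) (hu i)).not_ge hik
  refine ⟨k, hφk, ?_⟩
  have key : ∀ j, φ k * φ j ≤ φ k ^ 2 / u k * u j := by
    intro j
    have hj : |φ j| ≤ |φ k| / u k * u j := (div_le_iff₀ (hu j)).mp (hk j (Finset.mem_univ j))
    calc φ k * φ j ≤ |φ k| * |φ j| := (le_abs_self _).trans_eq (abs_mul _ _)
      _ ≤ |φ k| * (|φ k| / u k * u j) := mul_le_mul_of_nonneg_left hj (abs_nonneg _)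
      _ = φ k ^ 2 / u k * u j := by rw [← sq_abs (φ k)]; ring
  calc effV A u k * φ k ^ 2 = ∑ j, A k j * (φ k ^ 2 / u k * u j) := by
        simp only [effV, Matrix.mulVec, dotProduct, div_eq_mul_inv, Finset.sum_mul]
        exact Finset.sum_congr rfl fun j _ => by ring
    _ ≤ ∑ j, A k j * (φ k * φ j) := by
        refine Finset.sum_le_sum fun j _ => ?_
        rcases eq_or_ne k j with rfl | hkj
        · rw [div_mul_cancel₀ _ (hu k).ne', sq]
        · exact mul_le_mul_of_nonpos_left (key j) (hZ k j hkj)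
    _ = φ k * A.mulVec φ k := by
        simp only [Matrix.mulVec, dotProduct, Finset.mul_sum]
        exact Finset.sum_congr rfl fun j _ => by ring

/-- Let `A` be a real symmetric `Z`-matrix, `u` a vector with positive entries,
`D ⊆ [N]`, and `φ` a local eigenvector of `A` on `[N]∖D` with eigenvalue `E`. Then there is
`k ∉ D` with `φ_k ≠ 0` and `(Au)_k/u_k ≤ E`; in particular `K_Ē ∖ D` is nonempty for any
`Ē ≥ E`. -/
theorem wells_nonempty {N : ℕ} (A : Matrix (Fin N) (Fin N) ℝ) (hA : A.IsSymm)
    (hZ : IsZMatrix A) (u : Fin N → ℝ) (hu : ∀ i, 0 < u i)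
    (D : Finset (Fin N)) (φ : Fin N → ℝ) (E : ℝ) (hφ : IsLocalEigenvector A Dᶜ E φ) :
    (∃ k ∈ Dᶜ, φ k ≠ 0 ∧ effV A u k ≤ E) ∧
      ∀ Ebar : ℝ, E ≤ Ebar → (wellSet A u Ebar \ D).Nonempty := by
  obtain ⟨hne, hsupp, heig⟩ := hφ
  obtain ⟨k, hk0, hk⟩ := hZ.exists_effV_mul_sq_le hu hne
  have hkD : k ∈ Dᶜ := by
    by_contra h
    exact hk0 (hsupp k h)
  have hkE : effV A u k ≤ E := by
    rw [heig k hkD] at hk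
    exact le_of_mul_le_mul_right (hk.trans_eq (by ring)) (by positivity)
  refine ⟨⟨k, hkD, hk0, hkE⟩, fun Ebar hE => ⟨k, ?_⟩⟩
  simpa [wellSet] using And.intro (hkE.trans hE) (Finset.mem_compl.mp hkD)
end
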